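/- Let S be an ℕ-graded commutative ring and let M be a ℤ-graded S-module whose grading is left-bounded and such that M_n is a finitely generated S_0-module for every n ∈ ℤ. Define F_S(M) = ⋂_{N ≥ 0} closure of Supp_{S_0}((M / S_{>0} M)_{≥ N}) in Spec S_0. Then M is a finitely generated S-module if and only if F_S(M) = ∅. -/

import Mathlib

/-!
Setting: `S` is an ℕ-graded commutative ring.  We realize this as: `S` is a commutative ring,
`R` is a commutative ring mapping isomorphically onto the degree-zero part `S_0` of `S`
(hypotheses `h0S`, `hinjS` below), and `𝒮 : ℕ → Submodule R S` is the grading.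
`M` is a ℤ-graded `S`-module with grading `ℳ : ℤ → Submodule R M`, with `S_m • M_n ⊆ M_{m+n}`.

STATEMENT 7: with `F_S(M) = ⋂_{N ≥ 0} closure(Supp_{S_0}((M/S_{>0}M)_{≥N})) ⊆ Spec S_0`,
and `M` left-bounded with finitely generated graded pieces over `S_0`, the module `M` is a
finitely generated `S`-module iff `F_S(M) = ∅`.

Here `Supp_{S_0} N = {P ∈ Spec S_0 : N_P ≠ 0}`; for the subquotient
`(M/S_{>0}M)_{≥N}` (the image of `M_{≥N} = ⊕_{n ≥ N} M_n` in `M/S_{>0}M`) this is the set of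
primes `P` of `S_0` such that some `x ∈ M_{≥N}` has `Ann_{S_0}(x + S_{>0}M) ⊆ P`.
-/

noncomputable section

/-- The irrelevant ideal `S_{>0} = ⊕_{n>0} S_n` of an ℕ-graded ring. -/
def irrIdeal {R S : Type*} [CommRing R] [CommRing S] [Algebra R S]
    (𝒮 : ℕ → Submodule R S) : Ideal S :=
  Ideal.span {s : S | ∃ n, 0 < n ∧ s ∈ 𝒮 n}

/-- `Supp_{S_0}((M/S_{>0}M)_{≥N}) ⊆ Spec S_0`: the set of primes `P` of `S_0 = R` at which the
localization of the `S_0`-module `(M/S_{>0}M)_{≥N}` is nonzero, i.e. such that some element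
`x` of `M_{≥N} = ⊕_{n≥N} M_n` has `{c ∈ S_0 : c • x ∈ S_{>0}M} ⊆ P`. -/
def suppQuotGe {R S M : Type*} [CommRing R] [CommRing S] [Algebra R S]
    [AddCommGroup M] [Module S M] [Module R M] [IsScalarTower R S M]
    (𝒮 : ℕ → Submodule R S) (ℳ : ℤ → Submodule R M) (N : ℤ) : Set (PrimeSpectrum R) :=
  {P | ∃ x ∈ (⨆ n ∈ {n : ℤ | N ≤ n}, ℳ n), ∀ c : R,
      c • x ∈ (irrIdeal 𝒮 • (⊤ : Submodule S M) : Submodule S M) → c ∈ P.asIdeal}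

/-- `F_S(M) = ⋂_{N ≥ 0} closure(Supp_{S_0}((M/S_{>0}M)_{≥N}))`, a closed subset of
`Spec S_0`. -/
def FSM {R S M : Type*} [CommRing R] [CommRing S] [Algebra R S]
    [AddCommGroup M] [Module S M] [Module R M] [IsScalarTower R S M]
    (𝒮 : ℕ → Submodule R S) (ℳ : ℤ → Submodule R M) : Set (PrimeSpectrum R) :=
  ⋂ N : ℕ, closure (suppQuotGe 𝒮 ℳ (N : ℤ))

section

variable {R S M : Type*} [CommRing R] [CommRing S] [Algebra R S]
  [AddCommGroup M] [Module S M] [Module R M] [IsScalarTower R S M]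
  (𝒮 : ℕ → Submodule R S) (ℳ : ℤ → Submodule R M)

lemma suppQuotGe_antitone : Antitone (suppQuotGe 𝒮 ℳ) := by
  rintro a b hab P ⟨x, hx, hP⟩
  refine ⟨x, ?_, hP⟩
  have hle : (⨆ n ∈ {n : ℤ | b ≤ n}, ℳ n) ≤ ⨆ n ∈ {n : ℤ | a ≤ n}, ℳ n :=
    biSup_mono fun n hn ↦ hab.trans hn
  exact hle hx

/-- The support of `(M/S_{>0}M)_{≥N}` is empty iff this subquotient vanishes. -/
lemma suppQuotGe_eq_empty_iff (N : ℤ) :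
    suppQuotGe 𝒮 ℳ N = ∅ ↔
      ∀ n, N ≤ n → ∀ x ∈ ℳ n, x ∈ (irrIdeal 𝒮 • (⊤ : Submodule S M) : Submodule S M) := by
  set J : Submodule S M := irrIdeal 𝒮 • (⊤ : Submodule S M)
  constructor
  · intro h n hn x hx
    by_contra hxJ
    let I : Ideal R := (J.restrictScalars R).comap (LinearMap.toSpanSingleton R M x)
    have hI : I ≠ ⊤ := by
      rw [Ideal.ne_top_iff_one]
      simpa [I] using hxJ
    obtain ⟨P, hP, hIP⟩ := Ideal.exists_le_maximal I hI
    have : (⟨P, hP.isPrime⟩ : PrimeSpectrum R) ∈ suppQuotGe 𝒮 ℳ N :=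
      ⟨x, Submodule.mem_iSup_of_mem n (Submodule.mem_iSup_of_mem hn hx),
        fun c hc ↦ hIP (by simpa [I] using hc)⟩
    simp [h] at this
  · intro h
    refine Set.eq_empty_of_forall_notMem ?_
    rintro P ⟨x, hx, hP⟩
    have hle : (⨆ n ∈ {n : ℤ | N ≤ n}, ℳ n) ≤ J.restrictScalars R :=
      iSup₂_le fun n hn y hy ↦ h n hn y hy
    exact P.2.ne_top ((Ideal.eq_top_iff_one _).2 (hP 1 (by simpa using hle hx)))

/-- By quasi-compactness of `Spec S_0`, `F_S(M)` is empty iff one of the supports is. -/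
lemma FSM_eq_empty_iff : FSM 𝒮 ℳ = ∅ ↔ ∃ N : ℕ, suppQuotGe 𝒮 ℳ (N : ℤ) = ∅ := by
  constructor
  · intro h
    by_contra! hne
    have := IsCompact.nonempty_iInter_of_sequence_nonempty_isCompact_isClosed
      (fun N : ℕ ↦ closure (suppQuotGe 𝒮 ℳ (N : ℤ)))
      (fun N ↦ closure_mono (suppQuotGe_antitone 𝒮 ℳ (by simp)))
      (fun N ↦ (hne N).closure) isClosed_closure.isCompact (fun N ↦ isClosed_closure)
    rw [FSM] at h
    simp [h] at this
  · rintro ⟨N, hN⟩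
    refine Set.eq_empty_of_forall_notMem fun P hP ↦ ?_
    have := Set.mem_iInter.1 hP N
    simp [hN] at this

/-- The `S`-submodule generated by the homogeneous elements of degree less than `N`. -/
def spanDegreeLT (S : Type*) [CommRing S] [Module S M] (ℳ : ℤ → Submodule R M) (N : ℤ) :
    Submodule S M :=
  Submodule.span S {x | ∃ k < N, x ∈ ℳ k}

omit [Algebra R S] [IsScalarTower R S M] in
lemma spanDegreeLT_mono : Monotone (spanDegreeLT S ℳ) := fun _ _ hab ↦
  Submodule.span_mono fun _ ⟨k, hk, hx⟩ ↦ ⟨k, hk.trans_le hab, hx⟩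

lemma fg_spanDegreeLT (hlb : ∃ B : ℤ, ∀ n < B, ℳ n = ⊥)
    (hfg : ∀ n : ℤ, Module.Finite R ↥(ℳ n)) (N : ℤ) : (spanDegreeLT S ℳ N).FG := by
  obtain ⟨B, hB⟩ := hlb
  choose t ht using fun n ↦ Module.Finite.iff_fg.1 (hfg n)
  classical
  refine ⟨(Finset.Ico B N).biUnion t, le_antisymm ?_ ?_⟩
  · refine Submodule.span_le.2 fun x hx ↦ ?_
    simp only [Finset.coe_biUnion, Set.mem_iUnion, Finset.mem_coe, Finset.mem_Ico] at hx
    obtain ⟨k, hk, hx⟩ := hx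
    exact Submodule.subset_span ⟨k, hk.2, ht k ▸ Submodule.subset_span hx⟩
  · refine Submodule.span_le.2 ?_
    rintro x ⟨k, hk, hx⟩
    by_cases hkB : k < B
    · rw [hB k hkB, Submodule.mem_bot] at hx
      simp [hx]
    · rw [← ht k] at hx
      refine Submodule.span_mono ?_ (Submodule.span_le_restrictScalars R S _ hx)
      exact_mod_cast Finset.subset_biUnion_of_mem t (Finset.mem_Ico.2 ⟨not_lt.1 hkB, hk⟩)

section

variable [DirectSum.Decomposition ℳ]

omit [Algebra R S] [IsScalarTower R S M] in
lemma exists_mem_spanDegreeLT (x : M) : ∃ N : ℕ, x ∈ spanDegreeLT S ℳ N := by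
  induction x using DirectSum.Decomposition.inductionOn ℳ with
  | zero => exact ⟨0, zero_mem _⟩
  | @homogeneous k x =>
    exact ⟨(k + 1).toNat, Submodule.subset_span ⟨k, by lia, x.2⟩⟩
  | add x y hx hy =>
    obtain ⟨a, ha⟩ := hx
    obtain ⟨b, hb⟩ := hy
    exact ⟨max a b, add_mem (spanDegreeLT_mono ℳ (by simp) ha)
      (spanDegreeLT_mono ℳ (by simp) hb)⟩

omit [Algebra R S] [IsScalarTower R S M] in
lemma exists_spanDegreeLT_eq_top [hM : Module.Finite S M] :
    ∃ N : ℕ, spanDegreeLT S ℳ N = ⊤ := by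
  obtain ⟨t, ht⟩ := hM.fg_top
  choose N hN using exists_mem_spanDegreeLT (S := S) ℳ
  refine ⟨t.sup N, top_le_iff.1 (ht ▸ Submodule.span_le.2 fun x hx ↦ ?_)⟩
  exact spanDegreeLT_mono ℳ (by exact_mod_cast Finset.le_sup (f := N) hx) (hN x)

variable {𝒮}

omit [IsScalarTower R S M] in
lemma coe_decompose_smul_of_mem
    (hsmul : ∀ (m : ℕ) (n : ℤ), ∀ s ∈ 𝒮 m, ∀ x ∈ ℳ n, s • x ∈ ℳ (m + n))
    {d : ℕ} {s : S} (hs : s ∈ 𝒮 d) (x : M) (n : ℤ) :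
    (DirectSum.decompose ℳ (s • x) n : M) = s • (DirectSum.decompose ℳ x (n - d) : M) := by
  induction x using DirectSum.Decomposition.inductionOn ℳ with
  | zero => simp
  | @homogeneous k x =>
    have hsx := hsmul d k s hs x x.2
    by_cases h : d + k = n
    · subst h
      rw [DirectSum.decompose_of_mem_same ℳ hsx, add_sub_cancel_left,
        DirectSum.decompose_of_mem_same ℳ x.2]
    · rw [DirectSum.decompose_of_mem_ne ℳ hsx h,
        DirectSum.decompose_of_mem_ne ℳ x.2 (by lia), smul_zero]
  | add x y hx hy => simp [smul_add, DirectSum.decompose_add, hx, hy]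

omit [IsScalarTower R S M] in
/-- Components of degree at least `N` of elements of `spanDegreeLT S ℳ N` lie in `S_{>0} M`. -/
lemma decompose_mem_irrIdeal_smul_of_mem_spanDegreeLT [GradedAlgebra 𝒮]
    (hsmul : ∀ (m : ℕ) (n : ℤ), ∀ s ∈ 𝒮 m, ∀ x ∈ ℳ n, s • x ∈ ℳ (m + n))
    {N n : ℤ} (hn : N ≤ n) {y : M} (hy : y ∈ spanDegreeLT S ℳ N) :
    (DirectSum.decompose ℳ y n : M) ∈ irrIdeal 𝒮 • (⊤ : Submodule S M) := by
  induction hy using Submodule.closure_induction with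
  | zero => simp
  | add x y _ _ hx hy =>
    rw [DirectSum.decompose_add]
    exact add_mem hx hy
  | smul_mem s x hx =>
    obtain ⟨k, hk, hx⟩ := hx
    induction s using DirectSum.Decomposition.inductionOn 𝒮 with
    | zero => simp
    | @homogeneous d s =>
      rw [coe_decompose_smul_of_mem ℳ hsmul s.2]
      by_cases h : k = n - d
      · exact Submodule.smul_mem_smul (Ideal.subset_span ⟨d, by lia, s.2⟩) trivial
      · rw [DirectSum.decompose_of_mem_ne ℳ hx h, smul_zero]
        exact zero_mem _
    | add a b ha hb =>
      rw [add_smul, DirectSum.decompose_add]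
      exact add_mem ha hb

omit [IsScalarTower R S M] in
/-- The degree `n` component of an element of `S_{>0} M` lies in every `S`-submodule containing
the components of `M` of degree less than `n`. -/
lemma decompose_mem_of_mem_irrIdeal_smul
    (hsmul : ∀ (m : ℕ) (n : ℤ), ∀ s ∈ 𝒮 m, ∀ x ∈ ℳ n, s • x ∈ ℳ (m + n))
    (Q : Submodule S M) {n : ℤ} (hQ : ∀ k < n, ∀ x ∈ ℳ k, x ∈ Q)
    {y : M} (hy : y ∈ irrIdeal 𝒮 • (⊤ : Submodule S M)) :
    (DirectSum.decompose ℳ y n : M) ∈ Q := by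
  induction hy using Submodule.smul_induction_on' with
  | add x _ y _ hx hy =>
    rw [DirectSum.decompose_add]
    exact add_mem hx hy
  | smul r hr m _ =>
    induction hr using Submodule.span_induction generalizing m with
    | zero => simp
    | add a b _ _ ha hb =>
      rw [add_smul, DirectSum.decompose_add]
      exact add_mem (ha m trivial) (hb m trivial)
    | smul a r _ hr =>
      rw [smul_eq_mul, mul_comm, mul_smul]
      exact hr (a • m) trivial
    | mem s hs =>
      obtain ⟨d, hd, hs⟩ := hs
      rw [coe_decompose_smul_of_mem ℳ hsmul hs]
      exact Q.smul_mem s (hQ (n - d) (by lia) _ (SetLike.coe_mem _))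

omit [IsScalarTower R S M] in
/-- Graded Nakayama: a left-bounded module is generated in degrees less than `N` as soon as
`M/S_{>0}M` vanishes in degrees at least `N`. -/
lemma spanDegreeLT_eq_top
    (hsmul : ∀ (m : ℕ) (n : ℤ), ∀ s ∈ 𝒮 m, ∀ x ∈ ℳ n, s • x ∈ ℳ (m + n))
    (hlb : ∃ B : ℤ, ∀ n < B, ℳ n = ⊥) {N : ℤ}
    (hN : ∀ n, N ≤ n → ∀ x ∈ ℳ n, x ∈ irrIdeal 𝒮 • (⊤ : Submodule S M)) :
    spanDegreeLT S ℳ N = ⊤ := by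
  obtain ⟨B, hB⟩ := hlb
  have key : ∀ (i : ℕ) (n : ℤ), n < B + i → ∀ x ∈ ℳ n, x ∈ spanDegreeLT S ℳ N := by
    intro i
    induction i with
    | zero =>
      intro n hn x hx
      rw [hB n (by simpa using hn), Submodule.mem_bot] at hx
      simp [hx]
    | succ i ih =>
      intro n hn x hx
      by_cases h : n < N
      · exact Submodule.subset_span ⟨n, h, hx⟩
      · rw [← DirectSum.decompose_of_mem_same ℳ hx]
        exact decompose_mem_of_mem_irrIdeal_smul ℳ hsmul _
          (fun k hk ↦ ih k (by push_cast at hn; lia)) (hN n (not_lt.1 h) x hx)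
  refine eq_top_iff.2 fun x _ ↦ ?_
  induction x using DirectSum.Decomposition.inductionOn ℳ with
  | zero => exact zero_mem _
  | @homogeneous k x => exact key (k + 1 - B).toNat k (by lia) x x.2
  | add x y hx hy => exact add_mem (hx trivial) (hy trivial)

end

end

/-- `M` is a finitely generated `S`-module iff `F_S(M) = ∅`. -/
theorem finite_iff_FSM_empty {R S M : Type*} [CommRing R] [CommRing S] [Algebra R S]
    (𝒮 : ℕ → Submodule R S) [GradedAlgebra 𝒮]
    (h0S : ∀ s ∈ 𝒮 0, ∃ r : R, algebraMap R S r = s)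
    (hinjS : Function.Injective (algebraMap R S))
    [AddCommGroup M] [Module S M] [Module R M] [IsScalarTower R S M]
    (ℳ : ℤ → Submodule R M) [DirectSum.Decomposition ℳ]
    (hsmul : ∀ (m : ℕ) (n : ℤ), ∀ s ∈ 𝒮 m, ∀ x ∈ ℳ n, s • x ∈ ℳ (m + n))
    (hlb : ∃ B : ℤ, ∀ n < B, ℳ n = ⊥)
    (hfg : ∀ n : ℤ, Module.Finite R ↥(ℳ n)) :
    Module.Finite S M ↔ FSM 𝒮 ℳ = ∅ := by
  rw [FSM_eq_empty_iff]
  simp_rw [suppQuotGe_eq_empty_iff]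
  constructor
  · intro hM
    obtain ⟨N, hN⟩ := exists_spanDegreeLT_eq_top (S := S) ℳ
    refine ⟨N, fun n hn x hx ↦ ?_⟩
    rw [← DirectSum.decompose_of_mem_same ℳ hx]
    exact decompose_mem_irrIdeal_smul_of_mem_spanDegreeLT ℳ hsmul hn (hN ▸ trivial)
  · rintro ⟨N, hN⟩
    exact ⟨spanDegreeLT_eq_top ℳ hsmul hlb hN ▸ fg_spanDegreeLT ℳ hlb hfg N⟩

end
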